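/- Every n-vertex cubic graph with girth at least g has a dominating set of size at most 3n/10 + C·n/g for some absolute constant C. -/

import Mathlib

namespace CubicDom
open SimpleGraph
section
variable {V : Type} {G : SimpleGraph V}

lemma egirth_le_of_paths {u v : V} {p q : G.Walk u v} (hp : p.IsPath) (hq : q.IsPath)
    (h : p ≠ q) : G.egirth ≤ ((p.length + q.length : ℕ) : ℕ∞) := by
  obtain ⟨a, b, p', q', h1, h2, h3⟩ := hp.exists_isCycle_of_ne hq h
  refine (egirth_le_length h3).trans ?_
  have l1 : p'.length ≤ p.length := by
    obtain ⟨r, s, rfl⟩ := h1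
    simp only [Walk.length_append]; omega
  have l2 : q'.length ≤ q.length := by
    obtain ⟨r, s, rfl⟩ := h2
    simp only [Walk.length_append]; omega
  rw [Walk.length_append, Walk.length_reverse]
  exact_mod_cast Nat.add_le_add l1 l2

lemma egirth_le_U {x w a b : V} {k : ℕ} (ha : G.Adj a w) (hb : G.Adj b w) (hab : a ≠ b)
    (hr : G.Reachable x w) (hw : G.dist x w = k + 1) (hxa : G.dist x a = k) (hxb : G.dist x b = k) :
    G.egirth ≤ ((2 * k + 2 : ℕ) : ℕ∞) := by
  obtain ⟨p, hp⟩ := (hr.trans ha.symm.reachable).exists_walk_length_eq_dist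
  obtain ⟨q, hq⟩ := (hr.trans hb.symm.reachable).exists_walk_length_eq_dist
  have h1 : (p.concat ha).IsPath := Walk.isPath_of_length_eq_dist _ (by simp [hp, hw, hxa])
  have h2 : (q.concat hb).IsPath := Walk.isPath_of_length_eq_dist _ (by simp [hq, hw, hxb])
  refine (egirth_le_of_paths h1 h2 ?_).trans ?_
  · intro h
    have := congrArg Walk.penultimate h
    simp at this
    exact hab this
  · simp only [Walk.length_concat, hp, hq, hxa, hxb]
    exact_mod_cast (by omega : k + 1 + (k + 1) ≤ 2 * k + 2)

lemma egirth_le_O {x w v : V} {k : ℕ} (hv : G.Adj v w)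
    (hr : G.Reachable x w) (hw : G.dist x w = k) (hxv : G.dist x v = k) :
    G.egirth ≤ ((2 * k + 1 : ℕ) : ℕ∞) := by
  classical
  obtain ⟨p, hp⟩ := (hr.trans hv.symm.reachable).exists_walk_length_eq_dist
  obtain ⟨q, hq⟩ := hr.exists_walk_length_eq_dist
  have h2 : q.IsPath := Walk.isPath_of_length_eq_dist _ hq
  have h0 : p.IsPath := Walk.isPath_of_length_eq_dist _ hp
  have hn : w ∉ p.support := by
    intro h
    have := p.length_takeUntil_lt_length h hv.ne'
    have := dist_le (p.takeUntil w h)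
    omega
  have h1 := h0.concat hn hv
  refine (egirth_le_of_paths h1 h2 ?_).trans ?_
  · intro h
    have := congrArg Walk.length h
    simp at this
    omega
  · simp only [Walk.length_concat, hp, hq, hxv, hw]
    exact_mod_cast (by omega : k + 1 + k ≤ 2 * k + 1)

/-- vertices at distance at most `k` from `w` on the side of `w` away from `v` -/
def Sd (G : SimpleGraph V) (w v : V) (k : ℕ) : Set V :=
  {x | G.Reachable x w ∧ G.dist x w ≤ k ∧ G.dist x v = G.dist x w + 1}

lemma self_mem_Sd {w v : V} (k : ℕ) (h : G.Adj w v) : w ∈ Sd G w v k := by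
  refine ⟨Reachable.refl _, by simp, ?_⟩
  simp [h]

lemma Sd_not_mem (a w : V) (k : ℕ) : w ∉ Sd G a w k := by
  rintro ⟨_, _, h⟩
  simp at h

lemma Sd_mono (a w : V) {k l : ℕ} (h : k ≤ l) : Sd G a w k ⊆ Sd G a w l :=
  fun _ hx => ⟨hx.1, hx.2.1.trans h, hx.2.2⟩

lemma Sd_disj {K k : ℕ} (hg : ((2 * K + 2 : ℕ) : ℕ∞) < G.egirth) (hk : k ≤ K) {a b w : V}
    (ha : G.Adj a w) (hb : G.Adj b w) (hab : a ≠ b) : Disjoint (Sd G a w k) (Sd G b w k) := by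
  rw [Set.disjoint_left]
  rintro x ⟨h1, h2, h3⟩ ⟨h4, h5, h6⟩
  have := egirth_le_U ha hb hab (h1.trans ha.reachable) h3 rfl (by omega)
  have h7 := hg.trans_le this
  have : 2 * K + 2 < 2 * G.dist x a + 2 := by exact_mod_cast h7
  omega

lemma Sd_sub {K k : ℕ} (hg : ((2 * K + 2 : ℕ) : ℕ∞) < G.egirth) (hk : k + 1 ≤ K) {a w v : V}
    (ha : G.Adj a w) (hv : G.Adj w v) (hav : a ≠ v) : Sd G a w k ⊆ Sd G w v (k + 1) := by
  rintro x ⟨h1, h2, h3⟩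
  have hr := h1.trans ha.reachable
  refine ⟨hr, by omega, ?_⟩
  rcases hv.diff_dist_adj (u := x) with h | h | h
  · exfalso
    have := egirth_le_O hv.symm hr rfl h
    have h7 := hg.trans_le this
    have : 2 * K + 2 < 2 * G.dist x w + 1 := by exact_mod_cast h7
    omega
  · exact h
  · exfalso
    have := egirth_le_U ha hv.symm hav hr h3 rfl (by omega)
    have h7 := hg.trans_le this
    have : 2 * K + 2 < 2 * G.dist x a + 2 := by exact_mod_cast h7
    omega
end
end CubicDom
namespace CubicDom
set_option linter.unusedSectionVars false
noncomputable def Ex {V : Type} [Fintype V] {M : ℕ} (f : (V → Fin M) → ℝ) : ℝ :=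
  open Classical in (∑ ω, f ω) / (Fintype.card (V → Fin M) : ℝ)

section
variable {V : Type} [Fintype V] {M : ℕ}

lemma Ex_add (f g : (V → Fin M) → ℝ) : Ex (fun ω => f ω + g ω) = Ex f + Ex g := by
  simp [Ex, Finset.sum_add_distrib, add_div]
lemma Ex_sub (f g : (V → Fin M) → ℝ) : Ex (fun ω => f ω - g ω) = Ex f - Ex g := by
  simp [Ex, Finset.sum_sub_distrib, sub_div]
lemma Ex_const_mul (c : ℝ) (f : (V → Fin M) → ℝ) : Ex (fun ω => c * f ω) = c * Ex f := by
  simp [Ex, ← Finset.mul_sum, mul_div_assoc]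
lemma Ex_mono {f g : (V → Fin M) → ℝ} (h : ∀ ω, f ω ≤ g ω) : Ex f ≤ Ex g := by
  unfold Ex
  gcongr
  exact h _
lemma Ex_sum {ι : Type*} (s : Finset ι) (f : ι → (V → Fin M) → ℝ) :
    Ex (fun ω => ∑ i ∈ s, f i ω) = ∑ i ∈ s, Ex (f i) := by
  unfold Ex
  rw [Finset.sum_comm, Finset.sum_div]
lemma Ex_const [NeZero M] (c : ℝ) : Ex (fun _ : V → Fin M => c) = c := by
  classical
  have : (M : ℝ) ≠ 0 := by exact_mod_cast NeZero.ne M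
  simp [Ex, this]
lemma exists_le_Ex [NeZero M] (f : (V → Fin M) → ℝ) : ∃ ω, f ω ≤ Ex f := by
  classical
  by_contra! h
  have hne : (Finset.univ : Finset (V → Fin M)).Nonempty := ⟨fun _ => 0, by simp⟩
  have h1 : ∑ ω : V → Fin M, Ex f < ∑ ω, f ω := Finset.sum_lt_sum_of_nonempty hne (fun ω _ => h ω)
  have hc : (0 : ℝ) < (Fintype.card (V → Fin M) : ℝ) := by
    exact_mod_cast Fintype.card_pos_iff.mpr ⟨fun _ => 0⟩
  have h2 : Ex f * (Fintype.card (V → Fin M) : ℝ) = ∑ ω, f ω := by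
    unfold Ex
    rw [div_mul_cancel₀ _ hc.ne']
  rw [Finset.sum_const, Finset.card_univ, nsmul_eq_mul, mul_comm, h2] at h1
  exact lt_irrefl _ h1

open Classical in
/-- mix two configurations -/
noncomputable def mix (S : Set V) (p : (V → Fin M) × (V → Fin M)) : (V → Fin M) × (V → Fin M) :=
  (fun v => if v ∈ S then p.1 v else p.2 v, fun v => if v ∈ S then p.2 v else p.1 v)

lemma mix_invol (S : Set V) : Function.Involutive (mix (M := M) S) := by
  rintro ⟨a, b⟩
  simp only [mix, Prod.mk.injEq]
  constructor <;> funext v <;> by_cases h : v ∈ S <;> simp [h]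

lemma Ex_mul [NeZero M] {S T : Set V} {f g : (V → Fin M) → ℝ} (hf : DependsOn f S) (hg : DependsOn g T)
    (hd : Disjoint S T) : Ex (fun ω => f ω * g ω) = Ex f * Ex g := by
  classical
  have hc : (0 : ℝ) < (Fintype.card (V → Fin M) : ℝ) := by
    exact_mod_cast Fintype.card_pos_iff.mpr ⟨fun _ => 0⟩
  have key : (∑ ω, f ω) * (∑ ω, g ω) = (Fintype.card (V → Fin M) : ℝ) * ∑ ω, f ω * g ω := by
    rw [Finset.sum_mul_sum, ← Fintype.sum_prod_type' (fun a b => f a * g b)]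
    have e := Equiv.sum_comp (Function.Involutive.toPerm _ (mix_invol (M := M) S))
      (fun p : (V → Fin M) × (V → Fin M) => f p.1 * g p.1)
    have e2 : ∀ p : (V → Fin M) × (V → Fin M),
        f (Function.Involutive.toPerm _ (mix_invol (M := M) S) p).1 * g (Function.Involutive.toPerm _ (mix_invol (M := M) S) p).1 = f p.1 * g p.2 := by
      rintro ⟨a, b⟩
      have h1 : f (mix S (a, b)).1 = f a := hf (fun i hi => by simp [mix, hi])
      have h2 : g (mix S (a, b)).1 = g b :=
        hg (fun i hi => by
          have : i ∉ S := fun h => Set.disjoint_left.mp hd h hi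
          simp [mix, this])
      simp only [Function.Involutive.coe_toPerm]
      rw [h1, h2]
    rw [Finset.sum_congr rfl (fun p _ => e2 p)] at e
    rw [e, Fintype.sum_prod_type]
    simp [Finset.sum_const, Finset.mul_sum]
  have hL : Ex (fun ω => f ω * g ω) = (∑ ω, f ω * g ω) / (Fintype.card (V → Fin M) : ℝ) := by
    unfold Ex; congr!
  have h1 : Ex f = (∑ ω, f ω) / (Fintype.card (V → Fin M) : ℝ) := by
    unfold Ex; congr!
  have h2 : Ex g = (∑ ω, g ω) / (Fintype.card (V → Fin M) : ℝ) := by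
    unfold Ex; congr!
  rw [hL, h1, h2]
  field_simp
  linarith [key]

lemma dependsOn_mul {S T : Set V} {f g : (V → Fin M) → ℝ} (hf : DependsOn f S) (hg : DependsOn g T) :
    DependsOn (fun ω => f ω * g ω) (S ∪ T) := by
  intro x y h
  show f x * g x = f y * g y
  rw [hf (fun i hi => h i (Or.inl hi)), hg (fun i hi => h i (Or.inr hi))]

open Classical in
/-- indicator -/
noncomputable def I (p : Prop) : ℝ := if p then 1 else 0

lemma dependsOn_I {S : Set V} {P : (V → Fin M) → Prop} (h : DependsOn P S) :
    DependsOn (fun ω => I (P ω)) S := by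
  intro x y hxy
  show I (P x) = I (P y)
  rw [h hxy]

lemma Ex_le_seed [NeZero M] (w : V) (k : ℕ) (hk : k ≤ M) :
    Ex (fun ω : V → Fin M => I (k ≤ (ω w : ℕ))) = ((M : ℝ) - k) / M := by
  classical
  have hM : (M : ℝ) ≠ 0 := by exact_mod_cast NeZero.ne M
  have hE : Ex (fun ω : V → Fin M => I (k ≤ (ω w : ℕ))) =
      (∑ ω : V → Fin M, I (k ≤ (ω w : ℕ))) / (Fintype.card (V → Fin M) : ℝ) := by
    unfold Ex; congr!
  rw [hE, Fintype.card_congr (Equiv.funSplitAt w (Fin M)),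
    ← Equiv.sum_comp (Equiv.funSplitAt w (Fin M)).symm, Fintype.sum_prod_type]
  have h3 : ∑ x : Fin M, I (k ≤ (x : ℕ)) = (M : ℝ) - k := by
    rw [Fin.sum_univ_eq_sum_range (fun i => I (k ≤ i)) M]
    unfold I
    have h5 := Finset.sum_boole (R := ℝ) (fun i => k ≤ i) (Finset.range M)
    have : (Finset.range M).filter (fun i => k ≤ i) = Finset.Ico k M := by
      ext i; simp; tauto
    rw [this, Nat.card_Ico, Nat.cast_sub hk] at h5
    rw [← h5]
    congr!
  have h4 : ∀ x : Fin M, ∀ y : ({j // j ≠ w} → Fin M),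
      ((Equiv.funSplitAt w (Fin M)).symm (x, y)) w = x := by
    intro x y; simp [Equiv.funSplitAt]
  simp only [h4, Finset.sum_const, Finset.card_univ, nsmul_eq_mul, ← Finset.mul_sum, h3,
    Fintype.card_prod, Fintype.card_fin]
  have hc : (Fintype.card ({j // j ≠ w} → Fin M) : ℝ) ≠ 0 := by
    have : 0 < Fintype.card ({j // j ≠ w} → Fin M) := Fintype.card_pos_iff.mpr ⟨fun _ => 0⟩
    exact_mod_cast this.ne'
  push_cast
  rw [mul_comm (M : ℝ), mul_div_mul_left _ _ hc]
end
end CubicDom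
namespace CubicDom
/-- status of a dart -/
inductive St : Type
  | al : St
  | go : St
  | de : St

section
variable {V : Type}

/-- `a` is a child of the dart from `w` to `v` -/
def Ch (G : SimpleGraph V) (w v a : V) : Prop := G.Adj a w ∧ a ≠ v

open Classical in
noncomputable def step1 (G : SimpleGraph V) (f : V → V → St) (w v : V) : St :=
  if f w v = St.al ∧ ∀ a, Ch G w v a → f a w = St.go then St.de else f w v

open Classical in
noncomputable def step2 (G : SimpleGraph V) (τ : V → ℕ) (r : ℕ) (f : V → V → St) (w v : V) : St :=
  if f w v = St.al ∧ (τ w = r ∨ ∃ a, Ch G w v a ∧ f a w = St.de) then St.de else f w v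

open Classical in
noncomputable def step3 (G : SimpleGraph V) (f : V → V → St) (w v : V) : St :=
  if f w v = St.al ∧ ∃ a, Ch G w v a ∧ f a w = St.de then St.go else f w v

noncomputable def st (G : SimpleGraph V) (τ : V → ℕ) : ℕ → V → V → St
  | 0 => fun _ _ => St.al
  | r + 1 => step3 G (step2 G τ r (step1 G (st G τ r)))

noncomputable def st1 (G : SimpleGraph V) (τ : V → ℕ) (r : ℕ) : V → V → St := step1 G (st G τ r)
noncomputable def st2 (G : SimpleGraph V) (τ : V → ℕ) (r : ℕ) : V → V → St :=
  step2 G τ r (st1 G τ r)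

lemma st_succ (G : SimpleGraph V) (τ : V → ℕ) (r : ℕ) :
    st G τ (r + 1) = step3 G (st2 G τ r) := rfl

/-- gone one round earlier -/
def Hg (G : SimpleGraph V) (τ : V → ℕ) : ℕ → V → V → Prop
  | 0 => fun _ _ => False
  | r + 1 => fun w v => st G τ r w v = St.go

variable {G : SimpleGraph V} {τ : V → ℕ}

lemma st1_go (r : ℕ) (w v : V) : st1 G τ r w v = St.go ↔ st G τ r w v = St.go := by
  unfold st1 step1; split_ifs with h <;> simp [h]

lemma st2_go (r : ℕ) (w v : V) : st2 G τ r w v = St.go ↔ st G τ r w v = St.go := by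
  rw [← st1_go]
  unfold st2 step2; split_ifs with h <;> simp [h]

lemma st_go_succ {r : ℕ} {w v : V} (h : st G τ r w v = St.go) : st G τ (r + 1) w v = St.go := by
  rw [← st2_go] at h
  rw [st_succ]
  unfold step3; simp [h]

lemma st_de_succ (r : ℕ) (w v : V) : st G τ (r + 1) w v = St.de ↔ st2 G τ r w v = St.de := by
  rw [st_succ]
  unfold step3; split_ifs with h <;> simp [h]

lemma Hg_go {r : ℕ} {w v : V} (h : Hg G τ r w v) : st G τ r w v = St.go := by
  cases r with
  | zero => exact h.elim
  | succ r => exact st_go_succ h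

lemma st1_de_of {r : ℕ} {w v : V} (h : st G τ r w v = St.de) : st1 G τ r w v = St.de := by
  unfold st1 step1; simp [h]

lemma st2_de_of {r : ℕ} {w v : V} (h : st1 G τ r w v = St.de) : st2 G τ r w v = St.de := by
  unfold st2 step2; simp [h]

lemma st1_al (r : ℕ) (w v : V) : st1 G τ r w v = St.al ↔
    st G τ r w v = St.al ∧ ¬ ∀ a, Ch G w v a → st G τ r a w = St.go := by
  unfold st1 step1; split_ifs with h
  · simp [h.1]; exact h.2
  · tauto

lemma st2_al (r : ℕ) (w v : V) : st2 G τ r w v = St.al ↔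
    st1 G τ r w v = St.al ∧ τ w ≠ r ∧ ∀ a, Ch G w v a → st1 G τ r a w ≠ St.de := by
  unfold st2 step2; split_ifs with h
  · simp only [false_iff]
    grind
  · grind

lemma st3_al (r : ℕ) (w v : V) : st G τ (r + 1) w v = St.al ↔
    st2 G τ r w v = St.al ∧ ∀ a, Ch G w v a → st2 G τ r a w ≠ St.de := by
  rw [st_succ]
  unfold step3; split_ifs with h
  · simp only [false_iff]
    grind
  · grind

/-- the invariant for `st` implies the one for `st1` -/
lemma inv1 {r : ℕ} {w v : V}
    (h : st G τ r w v = St.al ↔ r ≤ τ w ∧ (∀ a, Ch G w v a → st G τ r a w ≠ St.de) ∧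
      ¬ ∀ a, Ch G w v a → Hg G τ r a w) :
    st1 G τ r w v = St.al ↔ r ≤ τ w ∧ (∀ a, Ch G w v a → st G τ r a w ≠ St.de) ∧
      ¬ ∀ a, Ch G w v a → st G τ r a w = St.go := by
  rw [st1_al, h]
  constructor
  · tauto
  · rintro ⟨h1, h2, h3⟩
    exact ⟨⟨h1, h2, fun h4 => h3 (fun a ha => Hg_go (h4 a ha))⟩, h3⟩

lemma inv2 {r : ℕ} {w v : V}
    (h : st1 G τ r w v = St.al ↔ r ≤ τ w ∧ (∀ a, Ch G w v a → st G τ r a w ≠ St.de) ∧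
      ¬ ∀ a, Ch G w v a → st G τ r a w = St.go) :
    st2 G τ r w v = St.al ↔ r + 1 ≤ τ w ∧ (∀ a, Ch G w v a → st1 G τ r a w ≠ St.de) ∧
      ¬ ∀ a, Ch G w v a → st G τ r a w = St.go := by
  rw [st2_al, h]
  constructor
  · rintro ⟨⟨h1, h2, h3⟩, h4, h5⟩
    exact ⟨by omega, h5, h3⟩
  · rintro ⟨h1, h2, h3⟩
    exact ⟨⟨by omega, fun a ha h => h2 a ha (st1_de_of h), h3⟩, by omega, h2⟩

lemma inv3 {r : ℕ} {w v : V}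
    (h : st2 G τ r w v = St.al ↔ r + 1 ≤ τ w ∧ (∀ a, Ch G w v a → st1 G τ r a w ≠ St.de) ∧
      ¬ ∀ a, Ch G w v a → st G τ r a w = St.go) :
    st G τ (r + 1) w v = St.al ↔ r + 1 ≤ τ w ∧
      (∀ a, Ch G w v a → st G τ (r + 1) a w ≠ St.de) ∧
      ¬ ∀ a, Ch G w v a → Hg G τ (r + 1) a w := by
  rw [st3_al, h]
  simp only [Hg, ne_eq, st_de_succ]
  constructor
  · tauto
  · rintro ⟨h1, h2, h3⟩
    exact ⟨⟨h1, fun a ha h => h2 a ha (st2_de_of h), h3⟩, h2⟩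

lemma inv0 (hch : ∀ w v : V, ∃ a, Ch G w v a) (r : ℕ) (w v : V) :
    st G τ r w v = St.al ↔ r ≤ τ w ∧ (∀ a, Ch G w v a → st G τ r a w ≠ St.de) ∧
      ¬ ∀ a, Ch G w v a → Hg G τ r a w := by
  induction r generalizing w v with
  | zero =>
    obtain ⟨a, ha⟩ := hch w v
    simp only [st, Hg, true_iff]
    refine ⟨by omega, by simp, fun h => h a ha⟩
  | succ r ih => exact inv3 (inv2 (inv1 (ih w v)))

/-! The actual process. -/

def Jset (G : SimpleGraph V) (τ : V → ℕ) (r : ℕ) (A : V → Prop) (v : V) : Prop :=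
  A v ∧ (τ v = r ∨ (∀ u, G.Adj u v → ¬ A u) ∨
    ∃ w, A w ∧ G.Adj w v ∧ ∀ u, G.Adj u w → A u → u = v)

def Al (G : SimpleGraph V) (τ : V → ℕ) : ℕ → V → Prop
  | 0 => fun _ => True
  | r + 1 => fun v => Al G τ r v ∧ ¬ Jset G τ r (Al G τ r) v ∧
      ∀ u, G.Adj u v → ¬ Jset G τ r (Al G τ r) u

lemma dominated (R : ℕ) (v : V) (hv : ¬ Al G τ R v) :
    ∃ r < R, Jset G τ r (Al G τ r) v ∨ ∃ u, G.Adj u v ∧ Jset G τ r (Al G τ r) u := by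
  induction R with
  | zero => simp [Al] at hv
  | succ R ih =>
    by_cases h : Al G τ R v
    · refine ⟨R, by omega, ?_⟩
      simp only [Al] at hv
      by_contra! h2
      exact hv ⟨h, h2.1, h2.2⟩
    · obtain ⟨r, hr, h⟩ := ih h
      exact ⟨r, by omega, h⟩

lemma leaf_de {r : ℕ} (ih : ∀ v, Al G τ r v → ∀ w, G.Adj w v →
      (Al G τ r w → st G τ r w v = St.al) ∧ (¬ Al G τ r w → st G τ r w v = St.go))
    {w v : V} (hw : Al G τ r w) (hv : Al G τ r v) (hadj : G.Adj w v) :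
    st1 G τ r w v = St.de ↔ ∀ u, G.Adj u w → Al G τ r u → u = v := by
  have h1 := (ih v hv w hadj).1 hw
  have h2 : st1 G τ r w v = St.de ↔ ∀ a, Ch G w v a → st G τ r a w = St.go := by
    unfold st1 step1
    split_ifs with h
    · simp only [true_iff]; exact h.2
    · rw [h1]; simp only [reduceCtorEq, false_iff]; tauto
  rw [h2]
  constructor
  · intro h u hu hA
    by_contra hne
    have := h u ⟨hu, hne⟩
    rw [(ih w hw u hu).1 hA] at this
    cases this
  · rintro h a ⟨ha, hne⟩
    exact (ih w hw a ha).2 (fun hA => hne (h a ha hA))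

lemma st2_de_iff {r : ℕ} {w v : V} (h : st G τ r w v = St.al) :
    st2 G τ r w v = St.de ↔
      st1 G τ r w v = St.de ∨ τ w = r ∨ ∃ a, Ch G w v a ∧ st1 G τ r a w = St.de := by
  have h0 : st1 G τ r w v ≠ St.go := by rw [ne_eq, st1_go, h]; simp
  have h3 : st1 G τ r w v = St.al ∨ st1 G τ r w v = St.de := by
    cases h : st1 G τ r w v <;> simp_all
  unfold st2 step2
  split_ifs with h4
  · simp only [true_iff]; tauto
  · rcases h3 with h3 | h3
    · rw [h3]; simp only [reduceCtorEq, false_iff, false_or]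
      exact fun h5 => h4 ⟨h3, h5⟩
    · simp [h3]

lemma lemC (r : ℕ) : ∀ v, Al G τ r v → ∀ w, G.Adj w v →
      (Al G τ r w → st G τ r w v = St.al) ∧ (¬ Al G τ r w → st G τ r w v = St.go) := by
  induction r with
  | zero => intro v _ w _; simp [Al, st]
  | succ r ih =>
    intro v hv w hwv
    obtain ⟨hvA, hvJ, hvn⟩ := hv
    by_cases hw : Al G τ r w
    swap
    · have h1 := st_go_succ ((ih v hvA w hwv).2 hw)
      refine ⟨fun h => (hw h.1).elim, fun _ => h1⟩
    have hwJ := hvn w hwv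
    have hal := (ih v hvA w hwv).1 hw
    have h1 : st1 G τ r w v ≠ St.de := by
      rw [ne_eq, leaf_de ih hw hvA hwv]
      intro h
      exact hvJ ⟨hvA, Or.inr (Or.inr ⟨w, hw, hwv, h⟩)⟩
    have hτ : τ w ≠ r := fun h => hwJ ⟨hw, Or.inl h⟩
    have h1c : ∀ a, Ch G w v a → st1 G τ r a w ≠ St.de := by
      rintro a ⟨ha, hav⟩ hde
      by_cases haA : Al G τ r a
      · rw [leaf_de ih haA hw ha] at hde
        exact hwJ ⟨hw, Or.inr (Or.inr ⟨a, haA, ha, hde⟩)⟩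
      · have := (ih w hw a ha).2 haA
        rw [← st1_go, hde] at this
        cases this
    have h2 : st2 G τ r w v = St.al := by
      rw [st2_al]
      refine ⟨?_, hτ, h1c⟩
      have : st1 G τ r w v ≠ St.go := by rw [ne_eq, st1_go, hal]; simp
      cases h : st1 G τ r w v <;> simp_all
    have key : (∃ a, Ch G w v a ∧ st2 G τ r a w = St.de) ↔ ¬ Al G τ (r + 1) w := by
      constructor
      · rintro ⟨a, ⟨ha, hav⟩, hde⟩ hA
        apply hA.2.2 a ha
        by_cases haA : Al G τ r a
        · rw [st2_de_iff ((ih w hw a ha).1 haA)] at hde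
          rcases hde with h | h | ⟨b, ⟨hb, hbw⟩, h⟩
          · exact (h1c a ⟨ha, hav⟩ h).elim
          · exact ⟨haA, Or.inl h⟩
          · refine ⟨haA, Or.inr (Or.inr ?_)⟩
            by_cases hbA : Al G τ r b
            · exact ⟨b, hbA, hb, (leaf_de ih hbA haA hb).1 h⟩
            · have := (ih a haA b hb).2 hbA
              rw [← st1_go, h] at this
              cases this
        · have := (ih w hw a ha).2 haA
          rw [← st2_go, hde] at this
          cases this
      · intro hA
        have : ∃ u, G.Adj u w ∧ Jset G τ r (Al G τ r) u := by
          by_contra! h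
          exact hA ⟨hw, hwJ, h⟩
        obtain ⟨u, hu, hJ⟩ := this
        have huv : u ≠ v := fun h => hvJ (h ▸ hJ)
        refine ⟨u, ⟨hu, huv⟩, ?_⟩
        obtain ⟨huA, hJ⟩ := hJ
        rw [st2_de_iff ((ih w hw u hu).1 huA)]
        rcases hJ with h | h | ⟨b, hbA, hb, h⟩
        · exact Or.inr (Or.inl h)
        · exact (h w hu.symm hw).elim
        · refine Or.inr (Or.inr ⟨b, ⟨hb, ?_⟩, (leaf_de ih hbA huA hb).2 h⟩)
          rintro rfl
          exact huv (h v hwv.symm hvA).symm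
    rw [← key, st_succ]
    unfold step3
    constructor
    · intro h
      have h' : ¬ ∃ a, Ch G w v a ∧ st2 G τ r a w = St.de := by
        rw [key]; exact fun h2 => h2 h
      rw [if_neg (fun h3 => h' h3.2)]; exact h2
    · intro h
      rw [if_pos ⟨h2, h⟩]

lemma Al_tau {r : ℕ} {v : V} (h : Al G τ r v) : r ≤ τ v := by
  induction r with
  | zero => omega
  | succ r ih =>
    have h1 := ih h.1
    have h2 : τ v ≠ r := fun h3 => h.2.1 ⟨h.1, Or.inl h3⟩
    omega

lemma Al_ne_de {r : ℕ} {v w : V} (h : Al G τ r v) (hw : G.Adj w v) : st G τ r w v ≠ St.de := by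
  by_cases hA : Al G τ r w
  · rw [(lemC r v h w hw).1 hA]; simp
  · rw [(lemC r v h w hw).2 hA]; simp

lemma Al_H {r : ℕ} {v a b c : V} (h : Al G τ r v) (hn : ∀ u, G.Adj u v → u = a ∨ u = b ∨ u = c)
    (ha : G.Adj a v) (hb : G.Adj b v) (hc : G.Adj c v) : ¬ (Hg G τ r a v ∧ Hg G τ r b v) := by
  cases r with
  | zero => exact fun h => h.1
  | succ r =>
    rintro ⟨h1, h2⟩
    simp only [Hg] at h1 h2
    have hal := lemC r v h.1
    have hA : ¬ Al G τ r a := fun h3 => by rw [(hal a ha).1 h3] at h1; cases h1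
    have hB : ¬ Al G τ r b := fun h3 => by rw [(hal b hb).1 h3] at h2; cases h2
    by_cases hC : Al G τ r c
    · refine h.2.2 c hc ⟨hC, Or.inr (Or.inr ⟨v, h.1, hc.symm, ?_⟩)⟩
      intro u hu huA
      rcases hn u hu with rfl | rfl | rfl
      · exact (hA huA).elim
      · exact (hB huA).elim
      · rfl
    · refine h.2.1 ⟨h.1, Or.inr (Or.inl ?_)⟩
      intro u hu huA
      rcases hn u hu with rfl | rfl | rfl <;> contradiction

lemma J_not {r : ℕ} {v : V} (h : Jset G τ r (Al G τ r) v) (h1 : r + 1 ≤ τ v)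
    (h2 : ∀ w, G.Adj w v → st1 G τ r w v ≠ St.de) : ∀ w, G.Adj w v → st G τ r w v = St.go := by
  obtain ⟨hA, h | h | ⟨w, hw, hwv, h⟩⟩ := h
  · omega
  · intro w hw
    exact (lemC r v hA w hw).2 (h w hw)
  · exact (h2 w hwv ((leaf_de (lemC r) hw hA hwv).2 h)).elim
end
end CubicDom
namespace CubicDom
set_option linter.unusedSectionVars false
section
variable {V : Type} [Fintype V] {M : ℕ}

/-- seeds as natural numbers -/
def tw (ω : V → Fin M) : V → ℕ := fun v => (ω v : ℕ)

variable {G : SimpleGraph V} {K : ℕ}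

lemma dep_step1 (hg : ((2 * K + 2 : ℕ) : ℕ∞) < G.egirth) {k : ℕ} (hk : k + 1 ≤ K)
    {F : (V → Fin M) → V → V → St}
    (hF : ∀ w v, G.Adj w v → DependsOn (fun ω => F ω w v) (Sd G w v k)) (w v : V)
    (h : G.Adj w v) : DependsOn (fun ω => step1 G (F ω) w v) (Sd G w v (k + 1)) := by
  intro x y hxy
  have own : F x w v = F y w v := hF w v h (fun i hi => hxy i (Sd_mono w v (by omega) hi))
  have ch : ∀ a, Ch G w v a → F x a w = F y a w := fun a ha =>
    hF a w ha.1 (fun i hi => hxy i (Sd_sub hg hk ha.1 h ha.2 hi))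
  have h2 : (∀ a, Ch G w v a → F x a w = St.go) ↔ ∀ a, Ch G w v a → F y a w = St.go :=
    forall_congr' fun a => imp_congr_right fun ha => by rw [ch a ha]
  show step1 G (F x) w v = step1 G (F y) w v
  unfold step1
  exact @if_congr _ _ _ (_) (_) _ _ _ _ (by rw [own, h2]) rfl own

lemma dep_step2 (hg : ((2 * K + 2 : ℕ) : ℕ∞) < G.egirth) {k : ℕ} (hk : k + 1 ≤ K)
    {F : (V → Fin M) → V → V → St} (r : ℕ)
    (hF : ∀ w v, G.Adj w v → DependsOn (fun ω => F ω w v) (Sd G w v k)) (w v : V)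
    (h : G.Adj w v) : DependsOn (fun ω => step2 G (tw ω) r (F ω) w v) (Sd G w v (k + 1)) := by
  intro x y hxy
  have own : F x w v = F y w v := hF w v h (fun i hi => hxy i (Sd_mono w v (by omega) hi))
  have ch : ∀ a, Ch G w v a → F x a w = F y a w := fun a ha =>
    hF a w ha.1 (fun i hi => hxy i (Sd_sub hg hk ha.1 h ha.2 hi))
  have h2 : (∃ a, Ch G w v a ∧ F x a w = St.de) ↔ ∃ a, Ch G w v a ∧ F y a w = St.de :=
    exists_congr fun a => and_congr_right fun ha => by rw [ch a ha]
  have h3 : tw x w = tw y w := by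
    simp only [tw, hxy w (self_mem_Sd _ h)]
  show step2 G (tw x) r (F x) w v = step2 G (tw y) r (F y) w v
  unfold step2
  exact @if_congr _ _ _ (_) (_) _ _ _ _ (by rw [own, h2, h3]) rfl own

lemma dep_step3 (hg : ((2 * K + 2 : ℕ) : ℕ∞) < G.egirth) {k : ℕ} (hk : k + 1 ≤ K)
    {F : (V → Fin M) → V → V → St}
    (hF : ∀ w v, G.Adj w v → DependsOn (fun ω => F ω w v) (Sd G w v k)) (w v : V)
    (h : G.Adj w v) : DependsOn (fun ω => step3 G (F ω) w v) (Sd G w v (k + 1)) := by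
  intro x y hxy
  have own : F x w v = F y w v := hF w v h (fun i hi => hxy i (Sd_mono w v (by omega) hi))
  have ch : ∀ a, Ch G w v a → F x a w = F y a w := fun a ha =>
    hF a w ha.1 (fun i hi => hxy i (Sd_sub hg hk ha.1 h ha.2 hi))
  have h2 : (∃ a, Ch G w v a ∧ F x a w = St.de) ↔ ∃ a, Ch G w v a ∧ F y a w = St.de :=
    exists_congr fun a => and_congr_right fun ha => by rw [ch a ha]
  show step3 G (F x) w v = step3 G (F y) w v
  unfold step3
  exact @if_congr _ _ _ (_) (_) _ _ _ _ (by rw [own, h2]) rfl own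

lemma dep_st (hg : ((2 * K + 2 : ℕ) : ℕ∞) < G.egirth) (r : ℕ) (hr : 3 * r ≤ K) (w v : V)
    (h : G.Adj w v) :
    DependsOn (fun ω : V → Fin M => st G (tw ω) r w v) (Sd G w v (3 * r)) := by
  induction r generalizing w v with
  | zero => intro x y _; rfl
  | succ r ih =>
    have h0 := fun w v h => ih (by omega) w v h
    have h1 := dep_step1 hg (by omega) h0
    have h2 := dep_step2 hg (by omega) r h1
    exact dep_step3 hg (by omega) h2 w v h

lemma dep_st1 (hg : ((2 * K + 2 : ℕ) : ℕ∞) < G.egirth) (r : ℕ) (hr : 3 * r + 1 ≤ K) (w v : V)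
    (h : G.Adj w v) :
    DependsOn (fun ω : V → Fin M => st1 G (tw ω) r w v) (Sd G w v (3 * r + 1)) :=
  dep_step1 hg hr (fun w v h => dep_st hg r (by omega) w v h) w v h

lemma dep_st2 (hg : ((2 * K + 2 : ℕ) : ℕ∞) < G.egirth) (r : ℕ) (hr : 3 * r + 2 ≤ K) (w v : V)
    (h : G.Adj w v) :
    DependsOn (fun ω : V → Fin M => st2 G (tw ω) r w v) (Sd G w v (3 * r + 2)) :=
  dep_step2 hg hr r (fun w v h => dep_st1 hg r (by omega) w v h) w v h

lemma dep_Hg (hg : ((2 * K + 2 : ℕ) : ℕ∞) < G.egirth) (r : ℕ) (hr : 3 * r ≤ K) (w v : V)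
    (h : G.Adj w v) :
    DependsOn (fun ω : V → Fin M => Hg G (tw ω) r w v) (Sd G w v K) := by
  cases r with
  | zero => intro x y _; rfl
  | succ r =>
    intro x y hxy
    have := dep_st (M := M) hg r (by omega) w v h (fun i hi => hxy i (Sd_mono w v (by omega) hi))
    show (st G (tw x) r w v = St.go) = (st G (tw y) r w v = St.go)
    simp only at this
    rw [this]

lemma dep_prop {F : (V → Fin M) → St} {S T : Set V} (h : DependsOn F S) (hST : S ⊆ T)
    (P : St → Prop) : DependsOn (fun ω => P (F ω)) T := by
  intro x y hxy
  have : F x = F y := h (fun i hi => hxy i (hST hi))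
  simp only [this]

lemma dep_seed (r : ℕ) (v : V) : DependsOn (fun ω : V → Fin M => I (r ≤ tw ω v)) {v} := by
  intro x y hxy
  have : x v = y v := hxy v rfl
  simp only [tw, this]

lemma Ex_mul3 [NeZero M] (hg : ((2 * K + 2 : ℕ) : ℕ∞) < G.egirth) {a b w : V}
    (ha : G.Adj a w) (hb : G.Adj b w) (hab : a ≠ b) {t f1 f2 : (V → Fin M) → ℝ}
    (ht : DependsOn t {w}) (h1 : DependsOn f1 (Sd G a w K)) (h2 : DependsOn f2 (Sd G b w K)) :
    Ex (fun ω => t ω * (f1 ω * f2 ω)) = Ex t * (Ex f1 * Ex f2) := by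
  rw [Ex_mul ht (dependsOn_mul h1 h2), Ex_mul h1 h2 (Sd_disj hg le_rfl ha hb hab)]
  rw [Set.disjoint_singleton_left, Set.mem_union]
  have := Sd_not_mem (G := G) a w K
  have := Sd_not_mem (G := G) b w K
  tauto

lemma Ex_mul4 [NeZero M] (hg : ((2 * K + 2 : ℕ) : ℕ∞) < G.egirth) {a b c w : V}
    (ha : G.Adj a w) (hb : G.Adj b w) (hc : G.Adj c w) (hab : a ≠ b) (hac : a ≠ c) (hbc : b ≠ c)
    {t f1 f2 f3 : (V → Fin M) → ℝ}
    (ht : DependsOn t {w}) (h1 : DependsOn f1 (Sd G a w K)) (h2 : DependsOn f2 (Sd G b w K))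
    (h3 : DependsOn f3 (Sd G c w K)) :
    Ex (fun ω => t ω * (f1 ω * (f2 ω * f3 ω))) = Ex t * (Ex f1 * (Ex f2 * Ex f3)) := by
  rw [Ex_mul ht (dependsOn_mul h1 (dependsOn_mul h2 h3)), Ex_mul h1 (dependsOn_mul h2 h3),
    Ex_mul h2 h3 (Sd_disj hg le_rfl hb hc hbc)]
  · rw [Set.disjoint_union_right]
    exact ⟨Sd_disj hg le_rfl ha hb hab, Sd_disj hg le_rfl ha hc hac⟩
  · rw [Set.disjoint_singleton_left, Set.mem_union, Set.mem_union]
    have := Sd_not_mem (G := G) a w K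
    have := Sd_not_mem (G := G) b w K
    have := Sd_not_mem (G := G) c w K
    tauto

/-- survival fraction -/
noncomputable def sv (M r : ℕ) : ℝ := ((M : ℝ) - r) / M

/-- every vertex has exactly three neighbours -/
def Cub (G : SimpleGraph V) : Prop := ∀ v, ∃ a b c, a ≠ b ∧ a ≠ c ∧ b ≠ c ∧
  ∀ u, G.Adj u v ↔ u = a ∨ u = b ∨ u = c

lemma Cub.two (hG : Cub G) {w v : V} (h : G.Adj w v) :
    ∃ a b, a ≠ b ∧ ∀ u, Ch G w v u ↔ u = a ∨ u = b := by
  obtain ⟨a, b, c, h1, h2, h3, h4⟩ := hG w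
  have h5 := (h4 v).1 h.symm
  unfold Ch
  rcases h5 with rfl | rfl | rfl
  · exact ⟨b, c, h3, fun u => by rw [h4]; grind⟩
  · exact ⟨a, c, h2, fun u => by rw [h4]; grind⟩
  · exact ⟨a, b, h1, fun u => by rw [h4]; grind⟩

lemma Cub.one (hG : Cub G) (w v : V) : ∃ a, Ch G w v a := by
  obtain ⟨a, b, c, h1, h2, h3, h4⟩ := hG w
  by_cases h : a = v
  · exact ⟨b, (h4 b).2 (by simp), fun h5 => h1 (h.trans h5.symm)⟩
  · exact ⟨a, (h4 a).2 (by simp), h⟩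

lemma Ex_dart [NeZero M] (hG : Cub G) (hg : ((2 * K + 2 : ℕ) : ℕ∞) < G.egirth)
    {P Q : (V → Fin M) → V → V → Prop} (hQP : ∀ ω a b, Q ω a b → P ω a b)
    (dP : ∀ a b, G.Adj a b → DependsOn (fun ω => P ω a b) (Sd G a b K))
    (dQ : ∀ a b, G.Adj a b → DependsOn (fun ω => Q ω a b) (Sd G a b K))
    {p q : ℝ} (hp : ∀ a b, G.Adj a b → Ex (fun ω => I (P ω a b)) = p)
    (hq : ∀ a b, G.Adj a b → Ex (fun ω => I (Q ω a b)) = q) {w v : V} (h : G.Adj w v)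
    {r : ℕ} (hr : r ≤ M) :
    Ex (fun ω : V → Fin M => I (r ≤ tw ω w ∧ (∀ a, Ch G w v a → P ω a w) ∧
      ¬ ∀ a, Ch G w v a → Q ω a w)) = sv M r * (p ^ 2 - q ^ 2) := by
  obtain ⟨a, b, hab, hu⟩ := hG.two h
  have ha : G.Adj a w := ((hu a).2 (Or.inl rfl)).1
  have hb : G.Adj b w := ((hu b).2 (Or.inr rfl)).1
  have e : (fun ω : V → Fin M => I (r ≤ tw ω w ∧ (∀ a, Ch G w v a → P ω a w) ∧
      ¬ ∀ a, Ch G w v a → Q ω a w)) = fun ω => I (r ≤ tw ω w) * (I (P ω a w) * I (P ω b w)) -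
        I (r ≤ tw ω w) * (I (Q ω a w) * I (Q ω b w)) := by
    funext ω
    have h1 := hQP ω a w
    have h2 := hQP ω b w
    simp only [hu, forall_eq_or_imp, forall_eq]
    by_cases c0 : r ≤ tw ω w <;> by_cases c1 : P ω a w <;> by_cases c2 : P ω b w <;>
      by_cases c3 : Q ω a w <;> by_cases c4 : Q ω b w <;> simp_all [I]
  rw [e, Ex_sub, Ex_mul3 hg ha hb hab (dep_seed r w) (dependsOn_I (dP a w ha))
    (dependsOn_I (dP b w hb)), Ex_mul3 hg ha hb hab (dep_seed r w) (dependsOn_I (dQ a w ha))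
    (dependsOn_I (dQ b w hb)), hp a w ha, hp b w hb, hq a w ha, hq b w hb]
  have : Ex (fun ω : V → Fin M => I (r ≤ tw ω w)) = sv M r := Ex_le_seed w r hr
  rw [this]
  ring

/-- indicator polynomial for all of `q` and at most one of `h` -/
def Tf (q1 q2 q3 h1 h2 h3 : ℝ) : ℝ :=
  q1 * (q2 * q3) - h1 * (h2 * q3) - h1 * (q2 * h3) - q1 * (h2 * h3) + 2 * (h1 * (h2 * h3))

def Tp (q h : ℝ) : ℝ := q ^ 3 - 3 * h ^ 2 * q + 2 * h ^ 3

lemma Tf_eq {q1 q2 q3 h1 h2 h3 : Prop} (e1 : h1 → q1) (e2 : h2 → q2) (e3 : h3 → q3) :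
    Tf (I q1) (I q2) (I q3) (I h1) (I h2) (I h3) =
      I (q1 ∧ q2 ∧ q3 ∧ ¬ (h1 ∧ h2) ∧ ¬ (h1 ∧ h3) ∧ ¬ (h2 ∧ h3)) := by
  by_cases c1 : q1 <;> by_cases c2 : q2 <;> by_cases c3 : q3 <;> by_cases c4 : h1 <;>
    by_cases c5 : h2 <;> by_cases c6 : h3 <;> first | (exfalso; tauto) | (simp [Tf, I, *]; try norm_num)

lemma Ex_vert [NeZero M] (hg : ((2 * K + 2 : ℕ) : ℕ∞) < G.egirth)
    {P Q : (V → Fin M) → V → V → Prop}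
    (dP : ∀ a b, G.Adj a b → DependsOn (fun ω => P ω a b) (Sd G a b K))
    (dQ : ∀ a b, G.Adj a b → DependsOn (fun ω => Q ω a b) (Sd G a b K))
    {p q : ℝ} (hp : ∀ a b, G.Adj a b → Ex (fun ω => I (P ω a b)) = p)
    (hq : ∀ a b, G.Adj a b → Ex (fun ω => I (Q ω a b)) = q) {a b c v : V}
    (ha : G.Adj a v) (hb : G.Adj b v) (hc : G.Adj c v) (hab : a ≠ b) (hac : a ≠ c) (hbc : b ≠ c)
    {r : ℕ} (hr : r ≤ M) :
    Ex (fun ω : V → Fin M => I (r ≤ tw ω v) * Tf (I (P ω a v)) (I (P ω b v)) (I (P ω c v))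
      (I (Q ω a v)) (I (Q ω b v)) (I (Q ω c v))) = sv M r * Tp p q := by
  have P1 := dependsOn_I (dP a v ha)
  have P2 := dependsOn_I (dP b v hb)
  have P3 := dependsOn_I (dP c v hc)
  have Q1 := dependsOn_I (dQ a v ha)
  have Q2 := dependsOn_I (dQ b v hb)
  have Q3 := dependsOn_I (dQ c v hc)
  have e : (fun ω : V → Fin M => I (r ≤ tw ω v) * Tf (I (P ω a v)) (I (P ω b v)) (I (P ω c v))
      (I (Q ω a v)) (I (Q ω b v)) (I (Q ω c v))) = fun ω =>
      I (r ≤ tw ω v) * (I (P ω a v) * (I (P ω b v) * I (P ω c v)))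
      - I (r ≤ tw ω v) * (I (Q ω a v) * (I (Q ω b v) * I (P ω c v)))
      - I (r ≤ tw ω v) * (I (Q ω a v) * (I (P ω b v) * I (Q ω c v)))
      - I (r ≤ tw ω v) * (I (P ω a v) * (I (Q ω b v) * I (Q ω c v)))
      + 2 * (I (r ≤ tw ω v) * (I (Q ω a v) * (I (Q ω b v) * I (Q ω c v)))) := by
    funext ω
    unfold Tf
    ring
  have d := dep_seed (M := M) r v
  have : Ex (fun ω : V → Fin M => I (r ≤ tw ω v)) = sv M r := Ex_le_seed v r hr
  rw [e, Ex_add, Ex_sub, Ex_sub, Ex_sub, Ex_const_mul,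
    Ex_mul4 hg ha hb hc hab hac hbc d P1 P2 P3, Ex_mul4 hg ha hb hc hab hac hbc d Q1 Q2 P3,
    Ex_mul4 hg ha hb hc hab hac hbc d Q1 P2 Q3, Ex_mul4 hg ha hb hc hab hac hbc d P1 Q2 Q3,
    Ex_mul4 hg ha hb hc hab hac hbc d Q1 Q2 Q3, hp a v ha, hp b v hb, hp c v hc, hq a v ha,
    hq b v hb, hq c v hc, this]
  unfold Tp
  ring

end
end CubicDom
namespace CubicDom
set_option linter.unusedSectionVars false
section
/-- recursion for the probabilities -/
noncomputable def gam (s0 β χ h : ℝ) : ℝ := β - s0 * (χ ^ 2 - h ^ 2)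
noncomputable def bet (s0 s1 β χ h : ℝ) : ℝ :=
  gam s0 β χ h - s0 * (β ^ 2 - χ ^ 2) + s1 * (gam s0 β χ h ^ 2 - χ ^ 2)
noncomputable def chi (s0 s1 β χ h : ℝ) : ℝ :=
  bet s0 s1 β χ h - s1 * (bet s0 s1 β χ h ^ 2 - χ ^ 2)

noncomputable def sq (M : ℕ) : ℕ → ℝ × ℝ × ℝ
  | 0 => (1, 0, 0)
  | r + 1 => (bet (sv M r) (sv M (r + 1)) (sq M r).1 (sq M r).2.1 (sq M r).2.2,
      chi (sv M r) (sv M (r + 1)) (sq M r).1 (sq M r).2.1 (sq M r).2.2, (sq M r).2.1)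

noncomputable def costJ (M r : ℕ) : ℝ :=
  sv M r * Tp (sq M r).1 (sq M r).2.2 -
    sv M (r + 1) * (Tp (gam (sv M r) (sq M r).1 (sq M r).2.1 (sq M r).2.2) (sq M r).2.2 -
      Tp (sq M r).2.1 (sq M r).2.2)

noncomputable def costA (M r : ℕ) : ℝ := sv M r * Tp (sq M r).1 (sq M r).2.2

variable {V : Type} [Fintype V] {M : ℕ} {G : SimpleGraph V} {K : ℕ}

lemma I_ne_de1 (τ : V → ℕ) (r : ℕ) (w v : V) : I (st1 G τ r w v ≠ St.de) =
    I (st G τ r w v ≠ St.de) - I (st G τ r w v = St.al) + I (st1 G τ r w v = St.al) := by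
  have h1 := st1_go (G := G) (τ := τ) r w v
  have h2 := st1_al (G := G) (τ := τ) r w v
  have h3 := st1_de_of (G := G) (τ := τ) (r := r) (w := w) (v := v)
  cases e1 : st G τ r w v <;> cases e2 : st1 G τ r w v <;> simp_all [I]

lemma I_ne_de2 (τ : V → ℕ) (r : ℕ) (w v : V) : I (st2 G τ r w v ≠ St.de) =
    I (st1 G τ r w v ≠ St.de) - I (st1 G τ r w v = St.al) + I (st2 G τ r w v = St.al) := by
  have h1 := st2_go (G := G) (τ := τ) r w v
  have h1' := st1_go (G := G) (τ := τ) r w v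
  have h2 := st2_al (G := G) (τ := τ) r w v
  have h3 := st2_de_of (G := G) (τ := τ) (r := r) (w := w) (v := v)
  rw [← h1'] at h1
  clear h1'
  cases e1 : st1 G τ r w v <;> cases e2 : st2 G τ r w v <;> simp_all [I]

lemma I_go (τ : V → ℕ) (r : ℕ) (w v : V) : I (st G τ r w v = St.go) =
    I (st G τ r w v ≠ St.de) - I (st G τ r w v = St.al) := by
  cases e1 : st G τ r w v <;> simp [I]

lemma go_ne_de {x : St} (h : x = St.go) : x ≠ St.de := by rw [h]; simp

lemma dep_st_P (hg : ((2 * K + 2 : ℕ) : ℕ∞) < G.egirth) (r : ℕ) (hr : 3 * r ≤ K) (P : St → Prop)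
    (w v : V) (h : G.Adj w v) :
    DependsOn (fun ω : V → Fin M => P (st G (tw ω) r w v)) (Sd G w v K) :=
  dep_prop (dep_st hg r hr w v h) (Sd_mono w v hr) P

lemma dep_st1_P (hg : ((2 * K + 2 : ℕ) : ℕ∞) < G.egirth) (r : ℕ) (hr : 3 * r + 1 ≤ K)
    (P : St → Prop) (w v : V) (h : G.Adj w v) :
    DependsOn (fun ω : V → Fin M => P (st1 G (tw ω) r w v)) (Sd G w v K) :=
  dep_prop (dep_st1 hg r hr w v h) (Sd_mono w v hr) P

lemma dep_st2_P (hg : ((2 * K + 2 : ℕ) : ℕ∞) < G.egirth) (r : ℕ) (hr : 3 * r + 2 ≤ K)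
    (P : St → Prop) (w v : V) (h : G.Adj w v) :
    DependsOn (fun ω : V → Fin M => P (st2 G (tw ω) r w v)) (Sd G w v K) :=
  dep_prop (dep_st2 hg r hr w v h) (Sd_mono w v hr) P

lemma bool_ineq {J a X b Y Z : Prop} (h1 : J → a ∧ X) (h2 : Z → Y) (h3 : J → b → Y → Z)
    (h4 : b → Y → ¬ Z → a ∧ X) : I J ≤ I a * I X - I b * (I Y - I Z) := by
  have h9 : ∀ p, 0 ≤ I p := fun p => by unfold I; split_ifs <;> norm_num
  have hax := mul_nonneg (h9 a) (h9 X)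
  by_cases cb : b
  swap
  · have e : I b = 0 := if_neg cb
    rw [e, zero_mul, sub_zero]
    by_cases cJ : J
    · obtain ⟨ca, cX⟩ := h1 cJ
      simp [I, *]
    · have e2 : I J = 0 := if_neg cJ
      rw [e2]; exact hax
  by_cases cY : Y
  swap
  · have cZ : ¬ Z := fun h => cY (h2 h)
    have e : I Y = 0 := if_neg cY
    have e' : I Z = 0 := if_neg cZ
    rw [e, e', sub_zero, mul_zero, sub_zero]
    by_cases cJ : J
    · obtain ⟨ca, cX⟩ := h1 cJ
      simp [I, *]
    · have e2 : I J = 0 := if_neg cJ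
      rw [e2]; exact hax
  have e : I Y = 1 := if_pos cY
  by_cases cZ : Z
  · have e' : I Z = 1 := if_pos cZ
    rw [e, e', sub_self, mul_zero, sub_zero]
    by_cases cJ : J
    · obtain ⟨ca, cX⟩ := h1 cJ
      simp [I, *]
    · have e2 : I J = 0 := if_neg cJ
      rw [e2]; exact hax
  · obtain ⟨ca, cX⟩ := h4 cb cY cZ
    have cJ : ¬ J := fun h => cZ (h3 h cb cY)
    simp [I, *]

section
variable [NeZero M] (hG : Cub G) (hg : ((2 * K + 2 : ℕ) : ℕ∞) < G.egirth)
include hG hg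

lemma Ex_st1 {r : ℕ} (hr : 3 * r + 1 ≤ K) (hM : r ≤ M) {β χ h : ℝ}
    (hβ : ∀ w v, G.Adj w v → Ex (fun ω : V → Fin M => I (st G (tw ω) r w v ≠ St.de)) = β)
    (hχ : ∀ w v, G.Adj w v → Ex (fun ω : V → Fin M => I (st G (tw ω) r w v = St.go)) = χ)
    (hh : ∀ w v, G.Adj w v → Ex (fun ω : V → Fin M => I (Hg G (tw ω) r w v)) = h)
    {w v : V} (hwv : G.Adj w v) :
    Ex (fun ω : V → Fin M => I (st1 G (tw ω) r w v ≠ St.de)) = gam (sv M r) β χ h ∧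
    Ex (fun ω : V → Fin M => I (st1 G (tw ω) r w v = St.al)) = sv M r * (β ^ 2 - χ ^ 2) := by
  have e1 : Ex (fun ω : V → Fin M => I (st G (tw ω) r w v = St.al)) =
      sv M r * (β ^ 2 - h ^ 2) := by
    have := Ex_dart (M := M) hG hg (P := fun ω a b => st G (tw ω) r a b ≠ St.de)
      (Q := fun ω a b => Hg G (tw ω) r a b)
      (fun ω a b hq => go_ne_de (Hg_go hq)) (dep_st_P hg r (by omega) (fun x => x ≠ St.de))
      (dep_Hg hg r (by omega)) hβ hh hwv hM
    rw [← this]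
    congr 1
    funext ω
    rw [inv0 hG.one]
  have e2 : Ex (fun ω : V → Fin M => I (st1 G (tw ω) r w v = St.al)) =
      sv M r * (β ^ 2 - χ ^ 2) := by
    have := Ex_dart (M := M) hG hg (P := fun ω a b => st G (tw ω) r a b ≠ St.de)
      (Q := fun ω a b => st G (tw ω) r a b = St.go)
      (fun ω a b hq => go_ne_de hq) (dep_st_P hg r (by omega) (fun x => x ≠ St.de))
      (dep_st_P hg r (by omega) (fun x => x = St.go)) hβ hχ hwv hM
    rw [← this]
    congr 1
    funext ω
    rw [inv1 (inv0 hG.one r w v)]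
  refine ⟨?_, e2⟩
  simp only [I_ne_de1]
  rw [Ex_add, Ex_sub, hβ w v hwv, e1, e2]
  unfold gam
  ring

lemma Ex_seq (r : ℕ) (hr : 3 * r ≤ K) (hM : r ≤ M) :
    (∀ w v, G.Adj w v → Ex (fun ω : V → Fin M => I (st G (tw ω) r w v ≠ St.de)) = (sq M r).1) ∧
    (∀ w v, G.Adj w v → Ex (fun ω : V → Fin M => I (st G (tw ω) r w v = St.go)) = (sq M r).2.1) ∧
    (∀ w v, G.Adj w v → Ex (fun ω : V → Fin M => I (Hg G (tw ω) r w v)) = (sq M r).2.2) := by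
  induction r with
  | zero =>
    refine ⟨fun w v _ => ?_, fun w v _ => ?_, fun w v _ => ?_⟩ <;>
    simp [st, Hg, I, sq, Ex_const]
  | succ r ih =>
    obtain ⟨hβ, hχ, hh⟩ := ih (by omega) (by omega)
    have h1 := fun w v hwv => Ex_st1 hG hg (r := r) (M := M) (by omega) (by omega) hβ hχ hh
      (w := w) (v := v) hwv
    have h2 : ∀ w v, G.Adj w v → Ex (fun ω : V → Fin M => I (st G (tw ω) (r + 1) w v ≠ St.de)) =
        (sq M (r + 1)).1 := by
      intro w v hwv
      have := Ex_dart (M := M) hG hg (P := fun ω a b => st1 G (tw ω) r a b ≠ St.de)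
        (Q := fun ω a b => st G (tw ω) r a b = St.go)
        (fun ω a b hq => go_ne_de ((st1_go r a b).2 hq))
        (dep_st1_P hg r (by omega) (fun x => x ≠ St.de))
        (dep_st_P hg r (by omega) (fun x => x = St.go)) (fun w v h => (h1 w v h).1) hχ hwv hM
      have e : Ex (fun ω : V → Fin M => I (st2 G (tw ω) r w v = St.al)) =
          sv M (r + 1) * (gam (sv M r) (sq M r).1 (sq M r).2.1 (sq M r).2.2 ^ 2 -
            (sq M r).2.1 ^ 2) := by
        rw [← this]
        congr 1
        funext ω
        rw [inv2 (inv1 (inv0 hG.one r w v))]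
      simp only [ne_eq, st_de_succ]
      simp only [← ne_eq, I_ne_de2]
      rw [Ex_add, Ex_sub, (h1 w v hwv).1, (h1 w v hwv).2, e]
      rfl
    have h3 : ∀ w v, G.Adj w v → Ex (fun ω : V → Fin M => I (Hg G (tw ω) (r + 1) w v)) =
        (sq M (r + 1)).2.2 := hχ
    refine ⟨h2, ?_, h3⟩
    intro w v hwv
    have := Ex_dart (M := M) hG hg (P := fun ω a b => st G (tw ω) (r + 1) a b ≠ St.de)
      (Q := fun ω a b => Hg G (tw ω) (r + 1) a b)
      (fun ω a b hq => go_ne_de (Hg_go hq)) (dep_st_P hg (r + 1) (by omega) (fun x => x ≠ St.de))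
      (dep_Hg hg (r + 1) (by omega)) h2 h3 hwv hM
    have e1 : Ex (fun ω : V → Fin M => I (st G (tw ω) (r + 1) w v = St.al)) =
        sv M (r + 1) * ((sq M (r + 1)).1 ^ 2 - (sq M (r + 1)).2.2 ^ 2) := by
      rw [← this]
      congr 1
      funext ω
      rw [inv0 hG.one]
    simp only [I_go]
    rw [Ex_sub, h2 w v hwv, e1]
    rfl

lemma Ex_A (r : ℕ) (hr : 3 * r ≤ K) (hM : r ≤ M) (v : V) :
    Ex (fun ω : V → Fin M => I (Al G (tw ω) r v)) ≤ costA M r := by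
  obtain ⟨hβ, hχ, hh⟩ := Ex_seq hG hg r hr hM
  obtain ⟨a, b, c, hab, hac, hbc, hn⟩ := hG v
  have ha : G.Adj a v := (hn a).2 (by simp)
  have hb : G.Adj b v := (hn b).2 (by simp)
  have hc : G.Adj c v := (hn c).2 (by simp)
  have := Ex_vert (M := M) hg (P := fun ω a b => st G (tw ω) r a b ≠ St.de)
      (Q := fun ω a b => Hg G (tw ω) r a b) (dep_st_P hg r (by omega) (fun x => x ≠ St.de))
      (dep_Hg hg r (by omega)) hβ hh ha hb hc hab hac hbc hM
  unfold costA
  rw [← this]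
  refine Ex_mono fun ω => ?_
  rw [Tf_eq (fun h => go_ne_de (Hg_go h)) (fun h => go_ne_de (Hg_go h))
    (fun h => go_ne_de (Hg_go h))]
  by_cases h : Al G (tw ω) r v
  · have h1 : r ≤ tw ω v := Al_tau h
    have h2 := Al_ne_de h ha
    have h3 := Al_ne_de h hb
    have h4 := Al_ne_de h hc
    have h5 := Al_H h (fun u hu => (hn u).1 hu) ha hb hc
    have h6 := Al_H (a := a) (b := c) (c := b) h (fun u hu => by have := (hn u).1 hu; tauto) ha hc hb
    have h7 := Al_H (a := b) (b := c) (c := a) h (fun u hu => by have := (hn u).1 hu; tauto) hb hc ha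
    have h8 : (st G (tw ω) r a v ≠ St.de ∧ st G (tw ω) r b v ≠ St.de ∧ st G (tw ω) r c v ≠ St.de ∧
      ¬ (Hg G (tw ω) r a v ∧ Hg G (tw ω) r b v) ∧ ¬ (Hg G (tw ω) r a v ∧ Hg G (tw ω) r c v) ∧
      ¬ (Hg G (tw ω) r b v ∧ Hg G (tw ω) r c v)) := ⟨h2, h3, h4, h5, h6, h7⟩
    unfold I
    rw [if_pos h, if_pos h1, if_pos h8]
    norm_num
  · have h9 : ∀ p, 0 ≤ I p := fun p => by unfold I; split_ifs <;> norm_num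
    have : I (Al G (tw ω) r v) = 0 := by simp [I, h]
    rw [this]
    exact mul_nonneg (h9 _) (h9 _)

lemma Ex_J (r : ℕ) (hr : 3 * r + 1 ≤ K) (hM : r + 1 ≤ M) (v : V) :
    Ex (fun ω : V → Fin M => I (Jset G (tw ω) r (Al G (tw ω) r) v)) ≤ costJ M r := by
  obtain ⟨hβ, hχ, hh⟩ := Ex_seq (M := M) hG hg r (by omega) (by omega)
  have h1 := fun w v hwv => Ex_st1 hG hg (r := r) (M := M) (by omega) (by omega) hβ hχ hh
      (w := w) (v := v) hwv
  obtain ⟨a, b, c, hab, hac, hbc, hn⟩ := hG v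
  have ha : G.Adj a v := (hn a).2 (by simp)
  have hb : G.Adj b v := (hn b).2 (by simp)
  have hc : G.Adj c v := (hn c).2 (by simp)
  have E1 := Ex_vert (M := M) hg (P := fun ω a b => st G (tw ω) r a b ≠ St.de)
      (Q := fun ω a b => Hg G (tw ω) r a b) (dep_st_P hg r (by omega) (fun x => x ≠ St.de))
      (dep_Hg hg r (by omega)) hβ hh ha hb hc hab hac hbc (r := r) (by omega)
  have E2 := Ex_vert (M := M) hg (P := fun ω a b => st1 G (tw ω) r a b ≠ St.de)
      (Q := fun ω a b => Hg G (tw ω) r a b) (dep_st1_P hg r (by omega) (fun x => x ≠ St.de))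
      (dep_Hg hg r (by omega)) (fun w v h => (h1 w v h).1) hh ha hb hc hab hac hbc hM
  have E3 := Ex_vert (M := M) hg (P := fun ω a b => st G (tw ω) r a b = St.go)
      (Q := fun ω a b => Hg G (tw ω) r a b) (dep_st_P hg r (by omega) (fun x => x = St.go))
      (dep_Hg hg r (by omega)) hχ hh ha hb hc hab hac hbc hM
  unfold costJ
  rw [mul_sub, ← E1, ← E2, ← E3, ← Ex_sub, ← Ex_sub]
  refine Ex_mono fun ω => ?_
  rw [Tf_eq (fun h => go_ne_de (Hg_go h)) (fun h => go_ne_de (Hg_go h))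
    (fun h => go_ne_de (Hg_go h)),
    Tf_eq (fun h => go_ne_de ((st1_go _ _ _).2 (Hg_go h)))
      (fun h => go_ne_de ((st1_go _ _ _).2 (Hg_go h)))
      (fun h => go_ne_de ((st1_go _ _ _).2 (Hg_go h))), Tf_eq Hg_go Hg_go Hg_go, ← mul_sub]
  apply bool_ineq
  · intro hJ
    have h := hJ.1
    have h1 : r ≤ tw ω v := Al_tau h
    have h2 := Al_ne_de h ha
    have h3 := Al_ne_de h hb
    have h4 := Al_ne_de h hc
    have h5 := Al_H h (fun u hu => (hn u).1 hu) ha hb hc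
    have h6 := Al_H (a := a) (b := c) (c := b) h (fun u hu => by have := (hn u).1 hu; tauto) ha hc hb
    have h7 := Al_H (a := b) (b := c) (c := a) h (fun u hu => by have := (hn u).1 hu; tauto) hb hc ha
    exact ⟨h1, h2, h3, h4, h5, h6, h7⟩
  · rintro ⟨h1, h2, h3, h4⟩
    exact ⟨go_ne_de ((st1_go _ _ _).2 h1), go_ne_de ((st1_go _ _ _).2 h2),
      go_ne_de ((st1_go _ _ _).2 h3), h4⟩
  · rintro hJ h1 ⟨h2, h3, h4, h5⟩
    have := J_not hJ h1 (fun w hw => by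
      rcases (hn w).1 hw with rfl | rfl | rfl <;> assumption)
    exact ⟨this a ha, this b hb, this c hc, h5⟩
  · rintro h1 ⟨h2, h3, h4, h5⟩ _
    exact ⟨by omega, fun h => h2 (st1_de_of h), fun h => h3 (st1_de_of h),
      fun h => h4 (st1_de_of h), h5⟩

lemma main_bound (R : ℕ) (hr : 3 * R ≤ K) (hM : R ≤ M) :
    ∃ D : Finset V, (∀ v : V, v ∈ D ∨ ∃ u ∈ D, G.Adj u v) ∧
      (D.card : ℝ) ≤ (∑ r ∈ Finset.range R, costJ M r + costA M R) * Fintype.card V := by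
  classical
  obtain ⟨ω, hω⟩ := exists_le_Ex (fun ω : V → Fin M => ∑ v : V,
    (∑ r ∈ Finset.range R, I (Jset G (tw ω) r (Al G (tw ω) r) v) + I (Al G (tw ω) R v)))
  let Pd : V → Prop := fun v => (∃ r < R, Jset G (tw ω) r (Al G (tw ω) r) v) ∨ Al G (tw ω) R v
  refine ⟨Finset.univ.filter Pd, ?_, ?_⟩
  · intro v
    simp only [Finset.mem_filter, Finset.mem_univ, true_and]
    by_cases h : Al G (tw ω) R v
    · exact Or.inl (Or.inr h)
    · obtain ⟨r, hr, h | ⟨u, hu, h⟩⟩ := dominated R v h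
      · exact Or.inl (Or.inl ⟨r, hr, h⟩)
      · exact Or.inr ⟨u, Or.inl ⟨r, hr, h⟩, hu⟩
  · have h9 : ∀ p, 0 ≤ I p := fun p => by unfold I; split_ifs <;> norm_num
    have h1 : ((Finset.univ.filter Pd).card : ℝ) ≤ ∑ v : V,
        (∑ r ∈ Finset.range R, I (Jset G (tw ω) r (Al G (tw ω) r) v) + I (Al G (tw ω) R v)) := by
      rw [Finset.card_filter, Nat.cast_sum]
      refine Finset.sum_le_sum fun v _ => ?_
      have h10 : 0 ≤ ∑ r ∈ Finset.range R, I (Jset G (tw ω) r (Al G (tw ω) r) v) :=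
        Finset.sum_nonneg fun _ _ => h9 _
      by_cases hp : Pd v
      · rw [if_pos hp]
        rcases hp with ⟨r, hr, h⟩ | h
        · have := Finset.single_le_sum (f := fun r => I (Jset G (tw ω) r (Al G (tw ω) r) v))
            (fun _ _ => h9 _) (Finset.mem_range.2 hr)
          have h11 : I (Jset G (tw ω) r (Al G (tw ω) r) v) = 1 := if_pos h
          have := h9 (Al G (tw ω) R v)
          push_cast
          linarith
        · have h11 : I (Al G (tw ω) R v) = 1 := if_pos h
          push_cast
          linarith
      · rw [if_neg hp]
        have := h9 (Al G (tw ω) R v)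
        push_cast
        linarith
    refine h1.trans (hω.trans ?_)
    rw [Ex_sum]
    have h2 : ∀ v : V, Ex (fun ω : V → Fin M => ∑ r ∈ Finset.range R,
        I (Jset G (tw ω) r (Al G (tw ω) r) v) + I (Al G (tw ω) R v)) ≤
        ∑ r ∈ Finset.range R, costJ M r + costA M R := by
      intro v
      rw [Ex_add, Ex_sum]
      refine add_le_add (Finset.sum_le_sum fun r hr' => ?_) (Ex_A hG hg R hr hM v)
      have := Finset.mem_range.1 hr'
      exact Ex_J hG hg r (by omega) (by omega) v
    refine (Finset.sum_le_sum fun v _ => h2 v).trans ?_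
    rw [Finset.sum_const, Finset.card_univ, nsmul_eq_mul, mul_comm]
end
end
end CubicDom
namespace CubicDom
/-! Fixed point ball arithmetic. -/
abbrev Ball : Type := ℤ × ℤ

def NN : ℤ := 2 ^ 150

def Bd (x : ℝ) (p : Ball) : Prop := |x * (NN : ℝ) - (p.1 : ℝ)| ≤ (p.2 : ℝ)

def badd (p q : Ball) : Ball := (p.1 + q.1, p.2 + q.2)
def bsub (p q : Ball) : Ball := (p.1 - q.1, p.2 + q.2)
def bmul (p q : Ball) : Ball :=
  (p.1 * q.1 / NN, (p.1.natAbs * q.2 + q.1.natAbs * p.2 + p.2 * q.2) / NN + 2)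

lemma Bd.add {x y : ℝ} {p q : Ball} (hx : Bd x p) (hy : Bd y q) : Bd (x + y) (badd p q) := by
  unfold Bd badd at *
  rw [abs_le] at *
  push_cast
  constructor <;> nlinarith

lemma Bd.sub {x y : ℝ} {p q : Ball} (hx : Bd x p) (hy : Bd y q) : Bd (x - y) (bsub p q) := by
  unfold Bd bsub at *
  rw [abs_le] at *
  push_cast
  constructor <;> nlinarith

lemma Bd.mul {x y : ℝ} {p q : Ball} (hx : Bd x p) (hy : Bd y q) : Bd (x * y) (bmul p q) := by
  obtain ⟨m1, e1⟩ := p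
  obtain ⟨m2, e2⟩ := q
  unfold Bd bmul at *
  simp only at *
  have hN : (0 : ℤ) < NN := by unfold NN; norm_num
  generalize NN = N at *
  have hNR : (0 : ℝ) < (N : ℝ) := by exact_mod_cast hN
  have key : |(x * N) * (y * N) - (m1 : ℝ) * m2| ≤
      |(m1 : ℝ)| * e2 + |(m2 : ℝ)| * e1 + (e1 : ℝ) * e2 := by
    have e : (x * N) * (y * N) - (m1 : ℝ) * m2 =
        m1 * (y * N - m2) + m2 * (x * N - m1) + (x * N - m1) * (y * N - m2) := by ring
    rw [e]
    refine (abs_add_le _ _).trans (add_le_add ((abs_add_le _ _).trans (add_le_add ?_ ?_)) ?_)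
    · rw [abs_mul]; gcongr
    · rw [abs_mul]; gcongr
    · rw [abs_mul]
      exact mul_le_mul hx hy (abs_nonneg _) ((abs_nonneg _).trans hx)
  have c1 : ((m1.natAbs : ℤ) : ℝ) = |(m1 : ℝ)| := by
    rw [Int.natCast_natAbs]; push_cast; rfl
  have c2 : ((m2.natAbs : ℤ) : ℝ) = |(m2 : ℝ)| := by
    rw [Int.natCast_natAbs]; push_cast; rfl
  set E : ℤ := (m1.natAbs : ℤ) * e2 + (m2.natAbs : ℤ) * e1 + e1 * e2 with hE
  have cE : (E : ℝ) = |(m1 : ℝ)| * e2 + |(m2 : ℝ)| * e1 + (e1 : ℝ) * e2 := by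
    rw [hE, Int.cast_add, Int.cast_add, Int.cast_mul, Int.cast_mul, Int.cast_mul, c1, c2]
  rw [← cE] at key
  set m : ℤ := m1 * m2 with hm
  have cm : (m : ℝ) = (m1 : ℝ) * m2 := by rw [hm]; push_cast; rfl
  rw [← cm] at key
  have d1 : (m : ℝ) = N * ((m / N : ℤ) : ℝ) + ((m % N : ℤ) : ℝ) := by
    exact_mod_cast (Int.mul_ediv_add_emod m N).symm
  have d2 : (E : ℝ) = N * ((E / N : ℤ) : ℝ) + ((E % N : ℤ) : ℝ) := by
    exact_mod_cast (Int.mul_ediv_add_emod E N).symm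
  have m0 : (0 : ℝ) ≤ ((m % N : ℤ) : ℝ) := by exact_mod_cast Int.emod_nonneg m hN.ne'
  have m1' : ((m % N : ℤ) : ℝ) ≤ N := by exact_mod_cast (Int.emod_lt_of_pos m hN).le
  have E0 : (0 : ℝ) ≤ ((E % N : ℤ) : ℝ) := by exact_mod_cast Int.emod_nonneg E hN.ne'
  have E1 : ((E % N : ℤ) : ℝ) ≤ N := by exact_mod_cast (Int.emod_lt_of_pos E hN).le
  push_cast
  rw [abs_le] at key ⊢
  constructor
  · refine le_of_mul_le_mul_left ?_ hNR
    nlinarith [key.1]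
  · refine le_of_mul_le_mul_left ?_ hNR
    nlinarith [key.2]

def bsv (r : ℕ) : Ball := ((256 - (r : ℤ)) * 2 ^ 142, 0)

lemma Bd_sv (r : ℕ) : Bd (sv 256 r) (bsv r) := by
  unfold Bd sv bsv NN
  push_cast
  refine le_of_eq ?_
  rw [abs_eq_zero]
  ring

def bT (q h : Ball) : Ball :=
  badd (bsub (bmul q (bmul q q)) (badd (bmul (bmul h h) q) (badd (bmul (bmul h h) q)
    (bmul (bmul h h) q)))) (badd (bmul (bmul h h) h) (bmul (bmul h h) h))

lemma Bd_T {q h : ℝ} {p k : Ball} (hq : Bd q p) (hh : Bd h k) : Bd (Tp q h) (bT p k) := by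
  have e : Tp q h = (q * (q * q) - (h * h * q + (h * h * q + h * h * q))) +
      (h * h * h + h * h * h) := by unfold Tp; ring
  rw [e]
  have a := (hh.mul hh).mul hq
  have b := (hh.mul hh).mul hh
  exact ((hq.mul (hq.mul hq)).sub (a.add (a.add a))).add (b.add b)

def bgam (s0 β χ h : Ball) : Ball := bsub β (bmul s0 (bsub (bmul χ χ) (bmul h h)))
def bbet (s0 s1 β χ g : Ball) : Ball :=
  badd (bsub g (bmul s0 (bsub (bmul β β) (bmul χ χ)))) (bmul s1 (bsub (bmul g g) (bmul χ χ)))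
def bchi (s1 χ b : Ball) : Ball := bsub b (bmul s1 (bsub (bmul b b) (bmul χ χ)))
def bcost (s0 s1 β χ h g : Ball) : Ball :=
  bsub (bmul s0 (bT β h)) (bmul s1 (bsub (bT g h) (bT χ h)))

/-- state: β, χ, h, accumulated cost -/
def bstep (s0 s1 : Ball) (x : Ball × Ball × Ball × Ball) : Ball × Ball × Ball × Ball :=
  (bbet s0 s1 x.1 x.2.1 (bgam s0 x.1 x.2.1 x.2.2.1),
   bchi s1 x.2.1 (bbet s0 s1 x.1 x.2.1 (bgam s0 x.1 x.2.1 x.2.2.1)), x.2.1,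
   badd x.2.2.2 (bcost s0 s1 x.1 x.2.1 x.2.2.1 (bgam s0 x.1 x.2.1 x.2.2.1)))

def bsq : ℕ → Ball × Ball × Ball × Ball
  | 0 => ((NN, 0), (0, 0), (0, 0), (0, 0))
  | r + 1 => bstep (bsv r) (bsv (r + 1)) (bsq r)

lemma Bd_sq (r : ℕ) : Bd (sq 256 r).1 (bsq r).1 ∧ Bd (sq 256 r).2.1 (bsq r).2.1 ∧
    Bd (sq 256 r).2.2 (bsq r).2.2.1 ∧
    Bd (∑ i ∈ Finset.range r, costJ 256 i) (bsq r).2.2.2 := by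
  induction r with
  | zero => simp [Bd, sq, bsq]
  | succ r ih =>
    obtain ⟨hβ, hχ, hh, hc⟩ := ih
    have s0 := Bd_sv r
    have s1 := Bd_sv (r + 1)
    have hg : Bd (gam (sv 256 r) (sq 256 r).1 (sq 256 r).2.1 (sq 256 r).2.2)
        (bgam (bsv r) (bsq r).1 (bsq r).2.1 (bsq r).2.2.1) := by
      unfold gam
      rw [pow_two, pow_two]
      exact hβ.sub (s0.mul ((hχ.mul hχ).sub (hh.mul hh)))
    have hb : Bd (sq 256 (r + 1)).1 (bsq (r + 1)).1 := by
      show Bd (bet _ _ _ _ _) _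
      unfold bet
      simp only [pow_two (sq 256 r).1, pow_two (sq 256 r).2.1, pow_two (gam _ _ _ _)]
      exact (hg.sub (s0.mul ((hβ.mul hβ).sub (hχ.mul hχ)))).add
        (s1.mul ((hg.mul hg).sub (hχ.mul hχ)))
    refine ⟨hb, ?_, hχ, ?_⟩
    · have e : (sq 256 (r + 1)).2.1 = (sq 256 (r + 1)).1 - sv 256 (r + 1) *
          ((sq 256 (r + 1)).1 * (sq 256 (r + 1)).1 - (sq 256 r).2.1 * (sq 256 r).2.1) := by
        rw [← pow_two, ← pow_two]; rfl
      rw [e]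
      exact hb.sub (s1.mul ((hb.mul hb).sub (hχ.mul hχ)))
    · rw [Finset.sum_range_succ]
      exact hc.add ((s0.mul (Bd_T hβ hh)).sub (s1.mul ((Bd_T hg hh).sub (Bd_T hχ hh))))

def btot (R : ℕ) : Ball := badd (bsq R).2.2.2 (bmul (bsv R) (bT (bsq R).1 (bsq R).2.2.1))

lemma btot_le : 10 * ((btot 30).1 + (btot 30).2) ≤ 3 * NN := by decide +kernel

lemma total_le : ∑ i ∈ Finset.range 30, costJ 256 i + costA 256 30 ≤ 3 / 10 := by
  obtain ⟨hβ, _, hh, hc⟩ := Bd_sq 30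
  have h : Bd (∑ i ∈ Finset.range 30, costJ 256 i + costA 256 30) (btot 30) :=
    hc.add ((Bd_sv 30).mul (Bd_T hβ hh))
  have h2 := (abs_le.1 h).2
  have h3 : (10 : ℝ) * (((btot 30).1 : ℝ) + ((btot 30).2 : ℝ)) ≤ 3 * (NN : ℝ) := by
    exact_mod_cast btot_le
  have hN : (0 : ℝ) < (NN : ℝ) := by unfold NN; norm_num
  by_contra! hcon
  nlinarith

end CubicDom

/-- Every `n`-vertex cubic graph with girth at least `g` has a dominating set of size at
most `3n/10 + C·n/g` for some absolute constant `C`. -/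
theorem stmt0 :
    ∃ C : ℝ, 0 < C ∧
      ∀ (V : Type) [Fintype V] (G : SimpleGraph V) [DecidableRel G.Adj] (g : ℕ),
        3 ≤ g → (∀ v : V, G.degree v = 3) → (g : ℕ∞) ≤ G.egirth →
        ∃ D : Finset V, (∀ v : V, v ∈ D ∨ ∃ u ∈ D, G.Adj u v) ∧
          (D.card : ℝ) ≤ 3 * (Fintype.card V) / 10 + C * (Fintype.card V) / g := by
  refine ⟨183, by norm_num, ?_⟩
  intro V _ G _ g hg3 hdeg hgirth
  have hg0 : (0 : ℝ) < (g : ℝ) := by exact_mod_cast (by omega : 0 < g)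
  have hn : (0 : ℝ) ≤ (Fintype.card V : ℝ) := Nat.cast_nonneg _
  by_cases hg : g < 183
  · refine ⟨Finset.univ, fun v => Or.inl (Finset.mem_univ v), ?_⟩
    rw [Finset.card_univ]
    have h1 : (g : ℝ) ≤ 183 := by exact_mod_cast hg.le
    have h2 : (Fintype.card V : ℝ) ≤ 183 * (Fintype.card V) / g := by
      rw [le_div_iff₀ hg0]
      nlinarith
    have h3 : (0 : ℝ) ≤ 3 * (Fintype.card V) / 10 := by positivity
    linarith
  · have hK : ((2 * 90 + 2 : ℕ) : ℕ∞) < G.egirth := by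
      refine lt_of_lt_of_le ?_ hgirth
      exact_mod_cast (by omega : 2 * 90 + 2 < g)
    have hC : CubicDom.Cub G := by
      classical
      intro v
      obtain ⟨a, b, c, h1, h2, h3, h4⟩ := Finset.card_eq_three.1 (hdeg v)
      refine ⟨a, b, c, h1, h2, h3, fun u => ?_⟩
      rw [G.adj_comm, ← SimpleGraph.mem_neighborFinset, h4]
      simp
    obtain ⟨D, hD, hc⟩ := CubicDom.main_bound (M := 256) hC hK 30 (by norm_num) (by norm_num)
    refine ⟨D, hD, hc.trans ?_⟩
    have h1 := mul_le_mul_of_nonneg_right CubicDom.total_le hn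
    have h2 : (0 : ℝ) ≤ 183 * (Fintype.card V) / g := by positivity
    linarith
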